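/- arXiv:2603.12182 — 5 statements merged into one kernel-verified Lean document; each statement's English description precedes it below -/
import Mathlib

section
/- Let N ≥ 1 and let Ω be the standard symplectic form on ℝ^{2N}. Let V_σ be a real symmetric 2N×2N matrix such that V_σ is positive definite and the complex matrix V_σ + iΩ is positive definite, and let V_ζ be a real symmetric 2N×2N matrix such that V_ζ + iΩ is positive semidefinite (as a complex matrix) and V_ζ − V_σ is invertible. Define γ_opt := −V_σ − X_{V_σ} (V_ζ − V_σ)⁻¹ X_{V_σ} (a real symmetric matrix). Then γ_opt is a bona fide quantum covariance matrix, i.e. γ_opt + iΩ is positive semidefinite as a complex matrix, if and only if V_σ − V_ζ is positive definite. -/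
open Matrix
open scoped ComplexOrder

noncomputable section

/-- The standard symplectic form on `ℝ^(2N)`: block diagonal with `N` blocks `[[0,1],[-1,0]]`. -/
def symp (N : ℕ) : Matrix (Fin (2*N)) (Fin (2*N)) ℝ :=
  Matrix.of fun i j =>
    if i.val % 2 = 0 ∧ j.val = i.val + 1 then 1
    else if j.val % 2 = 0 ∧ i.val = j.val + 1 then -1
    else 0

/-- View a real matrix as a complex matrix. -/
def cplx {n : Type*} (M : Matrix n n ℝ) : Matrix n n ℂ :=
  M.map (fun x => (x : ℂ))

/-- `V` is a bona fide quantum covariance matrix w.r.t. the symplectic form `Om`: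
the complex matrix `V + i·Om` is positive semidefinite. -/
def BonaFide {n : Type*} [Fintype n] (V Om : Matrix n n ℝ) : Prop :=
  (cplx V + Complex.I • cplx Om).PosSemidef

/-- The (positive semidefinite) square root of a positive semidefinite real matrix,
via the continuous functional calculus. -/
def msqrt {n : Type*} [Fintype n] [DecidableEq n] (M : Matrix n n ℝ) : Matrix n n ℝ :=
  cfc Real.sqrt M

/-- `X_V = V^{1/2} (I + A⁻²)^{1/2} V^{1/2}` where `A = V^{1/2} Ω V^{1/2}`. -/
def Xmat {n : Type*} [Fintype n] [DecidableEq n] (V Om : Matrix n n ℝ) : Matrix n n ℝ :=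
  msqrt V * msqrt (1 + (msqrt V * Om * msqrt V)⁻¹ * (msqrt V * Om * msqrt V)⁻¹) * msqrt V

section helpers

variable {n : Type*} [Fintype n] [DecidableEq n]

lemma cplx_eq (M : Matrix n n ℝ) : cplx M = Complex.ofRealHom.mapMatrix M := rfl

lemma cplx_mul (A B : Matrix n n ℝ) : cplx (A * B) = cplx A * cplx B := by
  simp only [cplx_eq, map_mul]

lemma cplx_sub (A B : Matrix n n ℝ) : cplx (A - B) = cplx A - cplx B := by
  simp only [cplx_eq, map_sub]

lemma cplx_add (A B : Matrix n n ℝ) : cplx (A + B) = cplx A + cplx B := by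
  simp only [cplx_eq, map_add]

lemma cplx_neg (A : Matrix n n ℝ) : cplx (-A) = -cplx A := by
  simp only [cplx_eq, map_neg]

lemma cplx_one : cplx (1 : Matrix n n ℝ) = 1 := by
  simp only [cplx_eq, map_one]

lemma cplx_isUnit {A : Matrix n n ℝ} (h : IsUnit A) : IsUnit (cplx A) := by
  rw [cplx_eq]; exact h.map _

lemma cplx_inv {A : Matrix n n ℝ} (h : IsUnit A) : cplx A⁻¹ = (cplx A)⁻¹ := by
  symm
  apply Matrix.inv_eq_right_inv
  rw [← cplx_mul, Matrix.mul_nonsing_inv _ ((Matrix.isUnit_iff_isUnit_det _).1 h), cplx_one]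

lemma cplx_conjTranspose (A : Matrix n n ℝ) : (cplx A)ᴴ = cplx Aᵀ := by
  ext i j
  simp [cplx]

lemma cplx_transpose (A : Matrix n n ℝ) : (cplx A)ᵀ = cplx Aᵀ := rfl

lemma cplx_quad (A : Matrix n n ℝ) (x : n → ℝ) :
    star (fun i => (x i : ℂ)) ⬝ᵥ (cplx A *ᵥ (fun i => (x i : ℂ)))
      = ((star x ⬝ᵥ (A *ᵥ x) : ℝ) : ℂ) := by
  simp [dotProduct, mulVec, cplx]

lemma posSemidef_of_cplx {A : Matrix n n ℝ} (hs : A.IsSymm) (h : (cplx A).PosSemidef) :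
    A.PosSemidef := by
  refine Matrix.PosSemidef.of_dotProduct_mulVec_nonneg ?_ ?_
  · rw [Matrix.IsHermitian, Matrix.conjTranspose_eq_transpose_of_trivial]; exact hs
  · intro x
    have := h.dotProduct_mulVec_nonneg (fun i => (x i : ℂ))
    rw [cplx_quad] at this
    exact_mod_cast this

lemma isUnit_of_cplx {A : Matrix n n ℝ} (h : IsUnit (cplx A)) : IsUnit A := by
  rw [Matrix.isUnit_iff_isUnit_det, isUnit_iff_ne_zero] at h ⊢
  intro h0
  apply h
  rw [cplx_eq, ← RingHom.map_det, h0, map_zero]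

lemma posDef_of_cplx {A : Matrix n n ℝ} (hs : A.IsSymm) (h : (cplx A).PosDef) :
    A.PosDef :=
  (posSemidef_of_cplx hs h.posSemidef).posDef_iff_isUnit.2 (isUnit_of_cplx h.isUnit)

open scoped MatrixOrder in
lemma cplx_posDef {A : Matrix n n ℝ} (h : A.PosDef) : (cplx A).PosDef := by
  have hp : (cplx A).PosSemidef := by
    obtain ⟨y, hy⟩ := CStarAlgebra.nonneg_iff_eq_star_mul_self.mp h.posSemidef.nonneg
    have : cplx A = (cplx y)ᴴ * cplx y := by
      rw [hy, cplx_mul, cplx_conjTranspose, Matrix.star_eq_conjTranspose,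
        Matrix.conjTranspose_eq_transpose_of_trivial]
    rw [this]
    exact Matrix.posSemidef_conjTranspose_mul_self _
  exact hp.posDef_iff_isUnit.2 (cplx_isUnit h.isUnit)

lemma inv_core {P W : Matrix n n ℂ} (hP : P.PosDef) (hu : IsUnit W)
    (hPW : (P - W).PosSemidef) : (W⁻¹ - P⁻¹).PosSemidef ↔ W.PosDef := by
  have hdW := (Matrix.isUnit_iff_isUnit_det _).1 hu
  constructor
  · intro h
    have h2 : (W⁻¹).PosDef := by
      have := Matrix.PosDef.posSemidef_add h hP.inv
      simpa using this
    exact Matrix.posDef_inv_iff.1 h2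
  · intro h
    have hWi := h.inv
    have : Invertible P := hP.isUnit.invertible
    have : Invertible W⁻¹ := hWi.isUnit.invertible
    have e1 := Matrix.PosDef.fromBlocks₁₁ (1 : Matrix n n ℂ) W⁻¹ hP
    have e2 := Matrix.PosDef.fromBlocks₂₂ P (1 : Matrix n n ℂ) hWi
    rw [Matrix.nonsing_inv_nonsing_inv _ hdW] at e2
    simp only [Matrix.conjTranspose_one, Matrix.one_mul, Matrix.mul_one] at e1 e2
    exact e1.1 (e2.2 hPW)

lemma msqrt_isSymm (M : Matrix n n ℝ) : (msqrt M).IsSymm := by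
  have h : IsSelfAdjoint (msqrt M) := cfc_predicate _ _
  have h' : (msqrt M)ᴴ = msqrt M := h
  rwa [Matrix.conjTranspose_eq_transpose_of_trivial] at h'

open scoped MatrixOrder in
lemma msqrt_mul_self {M : Matrix n n ℝ} (h : M.PosSemidef) : msqrt M * msqrt M = M := by
  have hsa : IsSelfAdjoint M := h.1
  unfold msqrt
  rw [← cfc_mul Real.sqrt Real.sqrt M]
  conv_rhs => rw [← cfc_id ℝ M]
  apply cfc_congr
  intro x hx
  exact Real.mul_self_sqrt (spectrum_nonneg_of_nonneg h.nonneg hx)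

lemma ring_core {P Q S D E K : Matrix n n ℂ} (hS : IsUnit S) (hD : IsUnit D)
    (hP : P = S * D * S) (hQ : Q = S * E * S) (hK : K * K = D * E) (hc : Commute K D) :
    (S * K * S) * P⁻¹ * (S * K * S) = Q := by
  obtain ⟨S, rfl⟩ := hS
  obtain ⟨D, rfl⟩ := hD
  have hPi : P⁻¹ = (↑S⁻¹ : Matrix n n ℂ) * (↑D⁻¹ : Matrix n n ℂ) * (↑S⁻¹ : Matrix n n ℂ) := by
    apply Matrix.inv_eq_right_inv
    subst hP
    simp [mul_assoc]
  have hc' : K * (↑D⁻¹ : Matrix n n ℂ) = (↑D⁻¹ : Matrix n n ℂ) * K := (hc.units_inv_right).eq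
  rw [hPi, hQ]
  calc _ = (S * (K * (↑D⁻¹ : Matrix n n ℂ)) * K * S : Matrix n n ℂ) := by simp [mul_assoc]
    _ = (S * (↑D⁻¹ : Matrix n n ℂ) * (K * K) * S : Matrix n n ℂ) := by rw [hc']; simp only [mul_assoc]
    _ = _ := by rw [hK]; simp [mul_assoc]

lemma general {Om V Z : Matrix n n ℝ} (hO : Om * Om = -1) (hOt : Omᵀ = -Om)
    (hVs : V.IsSymm) (hV : V.PosDef) (hVC : (cplx V + Complex.I • cplx Om).PosDef)
    (hZs : Z.IsSymm) (hZ : BonaFide Z Om) (hinv : IsUnit (Z - V)) :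
    BonaFide (-V - Xmat V Om * (Z - V)⁻¹ * Xmat V Om) Om ↔ (V - Z).PosDef := by
  have hSS := msqrt_mul_self hV.posSemidef
  have hSt := msqrt_isSymm V
  unfold Xmat
  set S := msqrt V with hSdef
  have hSu : IsUnit S := by
    have := hV.isUnit
    rw [← hSS] at this
    rw [Matrix.isUnit_iff_isUnit_det, Matrix.det_mul] at this
    exact (Matrix.isUnit_iff_isUnit_det _).2 (isUnit_of_mul_isUnit_left this)
  have hSdet := (Matrix.isUnit_iff_isUnit_det _).1 hSu
  have hBA : (S * Om * S)⁻¹ = -(S⁻¹ * Om * S⁻¹) := by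
    apply Matrix.inv_eq_right_inv
    have : S * Om * S * -(S⁻¹ * Om * S⁻¹) = -(S * Om * (S * S⁻¹) * Om * S⁻¹) := by
      simp only [Matrix.mul_assoc, Matrix.mul_neg]
    rw [this, Matrix.mul_nonsing_inv _ hSdet, Matrix.mul_one, Matrix.mul_assoc S, hO]
    simp [Matrix.mul_nonsing_inv _ hSdet]
  rw [hBA]
  set B := -(S⁻¹ * Om * S⁻¹) with hB
  have hBt : Bᵀ = -B := by
    rw [hB, Matrix.transpose_neg, Matrix.transpose_mul, Matrix.transpose_mul,
      Matrix.transpose_nonsing_inv, hSt.eq, hOt]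
    simp [Matrix.mul_assoc]
  have hOB : Om = -(S * B * S) := by
    have : S * B * S = -((S * S⁻¹) * Om * (S⁻¹ * S)) := by
      rw [hB]; simp only [Matrix.mul_assoc, Matrix.mul_neg, Matrix.neg_mul]
    rw [this, Matrix.mul_nonsing_inv _ hSdet, Matrix.nonsing_inv_mul _ hSdet]
    simp
  clear_value B
  set D : Matrix n n ℂ := 1 - Complex.I • cplx B with hD
  set E : Matrix n n ℂ := 1 + Complex.I • cplx B with hE
  have hP : cplx V + Complex.I • cplx Om = cplx S * D * cplx S := by
    rw [hD, hOB]
    conv_lhs => rw [← hSS]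
    simp [cplx_mul, cplx_neg, mul_add, add_mul, sub_eq_add_neg]
  have hQ : cplx V - Complex.I • cplx Om = cplx S * E * cplx S := by
    rw [hE, hOB]
    conv_lhs => rw [← hSS]
    simp [cplx_mul, cplx_neg, mul_add, add_mul]
  have hScu := cplx_isUnit hSu
  have hScs : star (cplx S) = cplx S := by
    rw [Matrix.star_eq_conjTranspose, cplx_conjTranspose, hSt.eq]
  have hDpd : D.PosDef := by
    rw [hP] at hVC
    rw [← Matrix.IsUnit.posDef_star_right_conjugate_iff hScu, hScs]
    exact hVC
  have hEpd : E.PosDef := by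
    have : E = Dᵀ := by
      rw [hD, hE, Matrix.transpose_sub, Matrix.transpose_smul, cplx_transpose, hBt, cplx_neg]
      simp
    rw [this]
    exact hDpd.transpose
  have hDE : cplx (1 + B * B) = D * E := by
    rw [hD, hE, cplx_add, cplx_one, cplx_mul]
    simp [mul_add, add_mul, sub_eq_add_neg, smul_smul]
  have hDE' : D * E = E * D := by
    rw [hD, hE]
    simp [mul_add, add_mul, sub_eq_add_neg, smul_smul]
    abel
  have hMs : (1 + B * B).IsSymm := by
    simp [Matrix.IsSymm, Matrix.transpose_add, Matrix.transpose_mul, hBt]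
  have hMpsd : (1 + B * B).PosSemidef := by
    apply posSemidef_of_cplx hMs
    have h1 := hEpd.posSemidef.conjTranspose_mul_mul_same D
    have h2 := hDpd.posSemidef.conjTranspose_mul_mul_same E
    rw [hDpd.1.eq] at h1
    rw [hEpd.1.eq] at h2
    have h3 := (h1.add h2).smul (show (0 : ℝ) ≤ 1 / 2 by norm_num)
    have h4 : D * E * D + E * D * E = (2 : ℝ) • (D * E) := by
      rw [← hDE']
      have : D + E = (2 : ℝ) • 1 := by
        rw [hD, hE, two_smul]; abel
      rw [← mul_add, this]; simp
    rw [h4, smul_smul] at h3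
    rw [hDE]
    simpa using h3
  have hKK := msqrt_mul_self hMpsd
  have hKt := msqrt_isSymm (1 + B * B)
  have hKB : Commute (msqrt (1 + B * B)) B := by
    apply Commute.cfc_real
    exact (Commute.one_left B).add_left ((Commute.refl B).mul_left (Commute.refl B))
  set K := msqrt (1 + B * B)
  have hKKc : cplx K * cplx K = D * E := by rw [← cplx_mul, hKK, hDE]
  have hKD : Commute (cplx K) D := by
    have : Commute (cplx K) (cplx B) := by
      unfold Commute SemiconjBy
      rw [← cplx_mul, ← cplx_mul, hKB.eq]
    exact (Commute.one_right _).sub_right (this.smul_right _)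
  have hKu : IsUnit (cplx K) := by
    have : IsUnit (cplx K * cplx K) := by
      rw [hKKc]; exact hDpd.isUnit.mul hEpd.isUnit
    rw [Matrix.isUnit_iff_isUnit_det, Matrix.det_mul] at this
    exact (Matrix.isUnit_iff_isUnit_det _).2 (isUnit_of_mul_isUnit_left this)
  have key := ring_core hScu hDpd.isUnit hP hQ hKKc hKD
  have hXu : IsUnit (cplx S * cplx K * cplx S) := (hScu.mul hKu).mul hScu
  have hKcs : star (cplx K) = cplx K := by
    rw [Matrix.star_eq_conjTranspose, cplx_conjTranspose, hKt.eq]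
  have hXs : star (cplx S * cplx K * cplx S) = cplx S * cplx K * cplx S := by
    rw [star_mul, star_mul, hScs, hKcs, mul_assoc]
  have hWu : IsUnit (V - Z) := by
    rw [← neg_sub]; exact hinv.neg
  have hWi : (Z - V)⁻¹ = -(V - Z)⁻¹ := by
    apply Matrix.inv_eq_right_inv
    rw [← neg_sub V Z, neg_mul_neg,
      Matrix.mul_nonsing_inv _ ((Matrix.isUnit_iff_isUnit_det _).1 hWu)]
  have hWs : (V - Z).IsSymm := hVs.sub hZs
  set X := cplx S * cplx K * cplx S with hX
  set P := cplx V + Complex.I • cplx Om with hPdef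
  have main : cplx (-V - (S * K * S) * (Z - V)⁻¹ * (S * K * S)) + Complex.I • cplx Om
      = X * ((cplx (V - Z))⁻¹ - P⁻¹) * star X := by
    rw [hXs, mul_sub, sub_mul, key, hWi, cplx_sub (-V), cplx_mul, cplx_mul _ (-_), cplx_neg,
      cplx_neg, cplx_inv hWu, cplx_mul, cplx_mul, ← hX]
    simp only [mul_neg, neg_mul]
    abel
  unfold BonaFide
  rw [main, Matrix.IsUnit.posSemidef_star_right_conjugate_iff hXu,
    inv_core hVC (cplx_isUnit hWu) ?_]
  · exact ⟨posDef_of_cplx hWs, cplx_posDef⟩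
  · have : P - cplx (V - Z) = cplx Z + Complex.I • cplx Om := by
      rw [hPdef, cplx_sub]; abel
    rw [this]
    exact hZ

end helpers

lemma symp_transpose (N : ℕ) : (symp N)ᵀ = -symp N := by
  ext i j
  simp only [symp, Matrix.transpose_apply, Matrix.of_apply, Matrix.neg_apply]
  split_ifs <;> first | omega | simp

lemma symp_sq (N : ℕ) : symp N * symp N = -1 := by
  ext i j
  have hi := i.2
  have hj := j.2
  rw [Matrix.mul_apply]
  obtain ⟨k, hk⟩ : ∃ k : Fin (2 * N), (i.val % 2 = 0 ∧ k.val = i.val + 1) ∨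
      (i.val % 2 = 1 ∧ k.val + 1 = i.val) := by
    rcases Nat.mod_two_eq_zero_or_one i.val with h | h
    · exact ⟨⟨i.val + 1, by omega⟩, Or.inl ⟨h, rfl⟩⟩
    · exact ⟨⟨i.val - 1, by omega⟩, Or.inr ⟨h, by simp only; omega⟩⟩
  rw [Finset.sum_eq_single k]
  · simp only [symp, Matrix.of_apply, Matrix.neg_apply, Matrix.one_apply, Fin.ext_iff]
    split_ifs <;> first | omega | norm_num
  · intro b _ hb
    have hb' : b.val ≠ k.val := fun h => hb (Fin.ext h)
    have : symp N i b = 0 := by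
      simp only [symp, Matrix.of_apply]
      split_ifs <;> first | omega | rfl
    rw [this, zero_mul]
  · simp

/-- `γ_opt = −V_σ − X_{V_σ}(V_ζ−V_σ)⁻¹X_{V_σ}` is a bona fide quantum covariance
matrix iff `V_σ − V_ζ` is positive definite. -/
theorem gammaOpt_bonaFide_iff (N : ℕ) (hN : 1 ≤ N)
    (Vσ Vζ : Matrix (Fin (2*N)) (Fin (2*N)) ℝ)
    (hVσsymm : Vσ.IsSymm) (hVσpd : Vσ.PosDef)
    (hVσpdC : (cplx Vσ + Complex.I • cplx (symp N)).PosDef)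
    (hVζsymm : Vζ.IsSymm)
    (hVζbf : BonaFide Vζ (symp N))
    (hinv : IsUnit (Vζ - Vσ)) :
    BonaFide (-Vσ - Xmat Vσ (symp N) * (Vζ - Vσ)⁻¹ * Xmat Vσ (symp N)) (symp N)
      ↔ (Vσ - Vζ).PosDef := by
  exact general (symp_sq N) (symp_transpose N) hVσsymm hVσpd hVσpdC hVζsymm hVζbf hinv
end
end

section
/- Let A, B, C be positive definite complex Hermitian n×n matrices such that B − A is positive definite. Then for every t ∈ [0,1), the matrix (B #_t C) − (A #_t C) is positive definite. -/
open Matrix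
open scoped ComplexOrder

noncomputable section

/-- Real power `M^t` of a (Hermitian) complex matrix, via the continuous functional calculus. -/
def mpowC {n : Type*} [Fintype n] [DecidableEq n] (M : Matrix n n ℂ) (t : ℝ) :
    Matrix n n ℂ :=
  cfc (fun x : ℝ => x ^ t) M

/-- The weighted matrix geometric mean `A #_t B = A^{1/2} (A^{−1/2} B A^{−1/2})^t A^{1/2}`. -/
def geomMeanC {n : Type*} [Fintype n] [DecidableEq n] (t : ℝ) (A B : Matrix n n ℂ) :
    Matrix n n ℂ :=
  mpowC A (1/2) * mpowC (mpowC A (-(1/2)) * B * mpowC A (-(1/2))) t * mpowC A (1/2)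

open scoped MatrixOrder Matrix.Norms.L2Operator in
lemma mpowC_eq {n : ℕ} (M : Matrix (Fin n) (Fin n) ℂ) (hM : 0 ≤ M) (t : ℝ) :
    mpowC M t = M ^ t := by
  rw [CFC.rpow_eq_cfc_real hM]; rfl

lemma aeval_intertwine {n : ℕ} (X Y Z : Matrix (Fin n) (Fin n) ℂ) (h : X * Z = Z * Y)
    (p : Polynomial ℝ) : Polynomial.aeval X p * Z = Z * Polynomial.aeval Y p := by
  induction p using Polynomial.induction_on' with
  | add p q hp hq => simp [add_mul, mul_add, hp, hq]
  | monomial k a =>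
    have hk : X ^ k * Z = Z * Y ^ k :=
      ((show SemiconjBy Z Y X from h.symm).pow_right k).symm
    simp [Polynomial.aeval_monomial, hk, Algebra.algebraMap_eq_smul_one]

lemma cfc_intertwine {n : ℕ} (X Y Z : Matrix (Fin n) (Fin n) ℂ) (hX : X.IsHermitian)
    (hY : Y.IsHermitian) (h : X * Z = Z * Y) (f : ℝ → ℝ) :
    cfc f X * Z = Z * cfc f Y := by
  classical
  have fX : (spectrum ℝ X).Finite := Matrix.finite_real_spectrum
  have fY : (spectrum ℝ Y).Finite := Matrix.finite_real_spectrum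
  let s := (fX.union fY).toFinset
  let p := Lagrange.interpolate s id f
  have hp : ∀ x ∈ s, p.eval x = f x := fun x hx => by
    exact Lagrange.eval_interpolate_at_node (v := id) f (by simp) hx
  have e1 : cfc f X = Polynomial.aeval X p := by
    rw [← cfc_polynomial p X hX]
    exact cfc_congr fun x hx => (hp x (by simp [s, hx])).symm
  have e2 : cfc f Y = Polynomial.aeval Y p := by
    rw [← cfc_polynomial p Y hY]
    exact cfc_congr fun x hx => (hp x (by simp [s, hx])).symm
  rw [e1, e2, aeval_intertwine X Y Z h]

lemma mpowC_posDef {n : ℕ} {M : Matrix (Fin n) (Fin n) ℂ} (hM : M.PosDef) (t : ℝ) :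
    (mpowC M t).PosDef := by
  open scoped MatrixOrder Matrix.Norms.L2Operator in
  rw [mpowC_eq M hM.posSemidef.nonneg]
  exact Matrix.isStrictlyPositive_iff_posDef.1 (IsStrictlyPositive.rpow M t hM.isStrictlyPositive)

lemma mpowC_add {n : ℕ} {M : Matrix (Fin n) (Fin n) ℂ} (hM : M.PosDef) (s t : ℝ) :
    mpowC M (s + t) = mpowC M s * mpowC M t := by
  open scoped MatrixOrder Matrix.Norms.L2Operator in
  rw [mpowC_eq M hM.posSemidef.nonneg, mpowC_eq M hM.posSemidef.nonneg,
    mpowC_eq M hM.posSemidef.nonneg]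
  exact CFC.rpow_add hM.isUnit

lemma mpowC_one {n : ℕ} {M : Matrix (Fin n) (Fin n) ℂ} (hM : M.PosDef) :
    mpowC M 1 = M := by
  open scoped MatrixOrder Matrix.Norms.L2Operator in
  rw [mpowC_eq M hM.posSemidef.nonneg]
  exact CFC.rpow_one M hM.posSemidef.nonneg

lemma mpowC_zero {n : ℕ} {M : Matrix (Fin n) (Fin n) ℂ} (hM : M.PosDef) :
    mpowC M 0 = 1 := by
  open scoped MatrixOrder Matrix.Norms.L2Operator in
  rw [mpowC_eq M hM.posSemidef.nonneg]
  exact CFC.rpow_zero M hM.posSemidef.nonneg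

lemma mpowC_mpowC {n : ℕ} {M : Matrix (Fin n) (Fin n) ℂ} (hM : M.PosDef) (s t : ℝ) (hs : s ≠ 0) :
    mpowC (mpowC M s) t = mpowC M (s * t) := by
  open scoped MatrixOrder Matrix.Norms.L2Operator in
  rw [mpowC_eq _ (mpowC_posDef hM s).posSemidef.nonneg, mpowC_eq M hM.posSemidef.nonneg,
    mpowC_eq M hM.posSemidef.nonneg]
  exact CFC.rpow_rpow M s t hs hM.isStrictlyPositive

lemma mpowC_mono {n : ℕ} {M N : Matrix (Fin n) (Fin n) ℂ} (hM : M.PosDef) (hN : N.PosDef)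
    (h : (N - M).PosSemidef) (t : ℝ) (ht : t ∈ Set.Icc (0 : ℝ) 1) :
    (mpowC N t - mpowC M t).PosSemidef := by
  open scoped MatrixOrder Matrix.Norms.L2Operator in
  rw [mpowC_eq M hM.posSemidef.nonneg, mpowC_eq N hN.posSemidef.nonneg]
  let _ : CStarAlgebra (Matrix (Fin n) (Fin n) ℂ) := {}
  exact CFC.rpow_le_rpow ht (show M ≤ N from h)

lemma mpowC_smul {n : ℕ} {M : Matrix (Fin n) (Fin n) ℂ} (hM : M.PosDef) (r : ℝ) (hr : 0 < r)
    (t : ℝ) : mpowC (r • M) t = r ^ t • mpowC M t := by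
  open scoped MatrixOrder in
  unfold mpowC
  have hf : (spectrum ℝ M).Finite := Matrix.finite_real_spectrum
  have hc : ∀ f : ℝ → ℝ, ContinuousOn f (spectrum ℝ M) := fun f => hf.continuousOn f
  rw [← cfc_smul _ _ _ (hc _)]
  refine (cfc_comp_smul r (fun x : ℝ => x ^ t) M ((hf.image _).continuousOn _)
    hM.isHermitian).symm.trans ?_
  refine cfc_congr fun x hx => ?_
  have hx0 : 0 ≤ x := spectrum_nonneg_of_nonneg hM.posSemidef.nonneg hx
  simp [Real.mul_rpow hr.le hx0]

lemma geomMean_symm {n : ℕ} {A C : Matrix (Fin n) (Fin n) ℂ} (hA : A.PosDef) (hC : C.PosDef)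
    (t : ℝ) : geomMeanC t A C = geomMeanC (1 - t) C A := by
  unfold geomMeanC
  have key : ∀ {M : Matrix (Fin n) (Fin n) ℂ}, M.PosDef → 
      (mpowC M (1/2) * mpowC M (1/2) = M) ∧ (mpowC M (1/2) * mpowC M (-(1/2)) = 1) ∧
      (mpowC M (-(1/2)) * mpowC M (1/2) = 1) := by
    intro M hM
    refine ⟨?_, ?_, ?_⟩ <;> rw [← mpowC_add hM] <;> norm_num [mpowC_one hM, mpowC_zero hM]
  obtain ⟨a1, a2, a3⟩ := key hA
  obtain ⟨c1, c2, c3⟩ := key hC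
  have hP := (mpowC_posDef hA (-(1/2)))
  have hQ := (mpowC_posDef hC (1/2))
  have hQ' := (mpowC_posDef hC (-(1/2)))
  have hPh := hP.isHermitian
  have hQh := hQ.isHermitian
  have hQh' := hQ'.isHermitian
  set P := mpowC A (1/2)
  set P' := mpowC A (-(1/2))
  set Q := mpowC C (1/2)
  set Q' := mpowC C (-(1/2))
  have hX : (P' * C * P').PosDef := by
    have := hC.conjTranspose_mul_mul_same (B := P') (Matrix.mulVec_injective_of_isUnit hP.isUnit)
    rwa [hPh.eq] at this
  have hV : (Q' * A * Q').PosDef := by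
    have := hA.conjTranspose_mul_mul_same (B := Q') (Matrix.mulVec_injective_of_isUnit hQ'.isUnit)
    rwa [hQh'.eq] at this
  have hW : (Q * (P' * P') * Q).PosDef := by
    have h1 : (P' * P').PosDef := by
      have := (PosDef.one (n := Fin n) (R := ℂ)).conjTranspose_mul_mul_same (B := P')
        (Matrix.mulVec_injective_of_isUnit hP.isUnit)
      simpa [hPh.eq] using this
    have := h1.conjTranspose_mul_mul_same (B := Q) (Matrix.mulVec_injective_of_isUnit hQ.isUnit)
    rwa [hQh.eq] at this
  have cQQ : ∀ x, Q * (Q' * x) = x := fun x => by rw [← mul_assoc, c2, one_mul]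
  have cQQ' : ∀ x, Q' * (Q * x) = x := fun x => by rw [← mul_assoc, c3, one_mul]
  have cPP : ∀ x, P * (P' * x) = x := fun x => by rw [← mul_assoc, a2, one_mul]
  have cPP' : ∀ x, P' * (P * x) = x := fun x => by rw [← mul_assoc, a3, one_mul]
  have hVW : mpowC (Q * (P' * P') * Q) (-1) = Q' * A * Q' := by
    have e1 : (Q * (P' * P') * Q) * (Q' * A * Q') = 1 := by
      simp only [← a1, mul_assoc, cQQ, cPP', c2]
    have e2 : mpowC (Q * (P' * P') * Q) (-1) * (Q * (P' * P') * Q) = 1 := by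
      conv_lhs => enter [2]; rw [← mpowC_one hW]
      rw [← mpowC_add hW]; norm_num [mpowC_zero hW]
    exact left_inv_eq_right_inv e2 e1
  have hI : mpowC (P' * C * P') (t - 1) * (P' * Q) = (P' * Q) * mpowC (Q * (P' * P') * Q) (t - 1) := by
    apply cfc_intertwine _ _ _ hX.isHermitian hW.isHermitian
    simp only [← c1, mul_assoc]
  rw [← hVW, mpowC_mpowC hW _ _ (by norm_num), show (-1 : ℝ) * (1 - t) = t - 1 by ring,
    show t = (t - 1) + 1 by ring, mpowC_add hX, mpowC_one hX]
  have e3 : P' * C * P' = (P' * Q) * (Q * P') := by simp only [← c1, mul_assoc]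
  conv_lhs => enter [1, 2, 2]; rw [e3]
  rw [← mul_assoc (mpowC _ (t - 1)) (P' * Q), hI]
  simp only [mul_assoc, cPP, a3, mul_one, add_sub_cancel_right]

/-- Strict domination leaves room for a scalar factor. -/
lemma exists_smul_le {n : ℕ} {A B : Matrix (Fin n) (Fin n) ℂ} (hA : A.PosDef)
    (hBA : (B - A).PosDef) : ∃ r : ℝ, 1 < r ∧ (B - r • A).PosSemidef := by
  open scoped MatrixOrder Matrix.Norms.L2Operator in
  let _ : CStarAlgebra (Matrix (Fin n) (Fin n) ℂ) := {}
  rcases subsingleton_or_nontrivial (Matrix (Fin n) (Fin n) ℂ) with h | h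
  · refine ⟨2, by norm_num, ?_⟩
    rw [Subsingleton.elim (B - (2 : ℝ) • A) 0]
    exact PosSemidef.zero
  · obtain ⟨c, hc, hcD⟩ := (CFC.exists_pos_algebraMap_le_iff hBA.isHermitian.isSelfAdjoint).2
      (fun x hx => hBA.isStrictlyPositive.spectrum_pos hx)
    have hK : A ≤ algebraMap ℝ _ ‖A‖ := IsSelfAdjoint.le_algebraMap_norm_self hA.isHermitian
    have hN := norm_nonneg A
    have hδ : 0 < c / (‖A‖ + 1) := by positivity
    refine ⟨1 + c / (‖A‖ + 1), by linarith, ?_⟩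
    have h1 : ((c / (‖A‖ + 1)) • (algebraMap ℝ (Matrix (Fin n) (Fin n) ℂ) ‖A‖ - A)).PosSemidef :=
      PosSemidef.smul (Matrix.le_iff.1 hK) hδ.le
    have h2 : (algebraMap ℝ (Matrix (Fin n) (Fin n) ℂ) (c / (‖A‖ + 1))).PosSemidef := by
      rw [Algebra.algebraMap_eq_smul_one]
      exact PosSemidef.one.smul hδ.le
    have h3 := ((Matrix.le_iff.1 hcD).add h1).add h2
    have e : c = (c / (‖A‖ + 1)) * ‖A‖ + c / (‖A‖ + 1) := by field_simp
    have e' : algebraMap ℝ (Matrix (Fin n) (Fin n) ℂ) c =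
        (c / (‖A‖ + 1)) • algebraMap ℝ (Matrix (Fin n) (Fin n) ℂ) ‖A‖ +
          algebraMap ℝ (Matrix (Fin n) (Fin n) ℂ) (c / (‖A‖ + 1)) := by
      conv_lhs => rw [e, map_add, map_mul]
      rw [Algebra.smul_def]
    have e3 : B - (1 + c / (‖A‖ + 1)) • A =
        B - A - algebraMap ℝ (Matrix (Fin n) (Fin n) ℂ) c +
          (c / (‖A‖ + 1)) • (algebraMap ℝ (Matrix (Fin n) (Fin n) ℂ) ‖A‖ - A) +
          algebraMap ℝ (Matrix (Fin n) (Fin n) ℂ) (c / (‖A‖ + 1)) := by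
      rw [e', add_smul, one_smul, smul_sub]
      abel
    rw [e3]
    exact h3

/-- strict monotonicity of the weighted geometric mean in its first argument:
if `A < B` then `A #_t C < B #_t C` for all `t ∈ [0,1)`. -/
theorem geomMean_strict_mono {n : ℕ} (A B C : Matrix (Fin n) (Fin n) ℂ)
    (hA : A.PosDef) (hB : B.PosDef) (hC : C.PosDef) (hBA : (B - A).PosDef)
    (t : ℝ) (ht : t ∈ Set.Ico (0 : ℝ) 1) :
    (geomMeanC t B C - geomMeanC t A C).PosDef := by
  obtain ⟨r, hr, hle⟩ := exists_smul_le hA hBA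
  rw [geomMean_symm hA hC, geomMean_symm hB hC]
  have hs : 0 < 1 - t := by linarith [ht.2]
  have hs1 : 1 - t ≤ 1 := by linarith [ht.1]
  generalize 1 - t = s at hs hs1
  unfold geomMeanC
  have hQ := (mpowC_posDef hC (1/2))
  have hQ' := (mpowC_posDef hC (-(1/2)))
  set Q := mpowC C (1/2)
  set Q' := mpowC C (-(1/2))
  have conj : ∀ {M : Matrix (Fin n) (Fin n) ℂ}, M.PosDef → (Q' * M * Q').PosDef := by
    intro M hM
    have := hM.conjTranspose_mul_mul_same (B := Q') (Matrix.mulVec_injective_of_isUnit hQ'.isUnit)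
    rwa [hQ'.isHermitian.eq] at this
  have hrX : (r • (Q' * A * Q')).PosDef := (conj hA).smul (by linarith)
  have h1 : (Q' * B * Q' - r • (Q' * A * Q')).PosSemidef := by
    have := hle.conjTranspose_mul_mul_same Q'
    rw [hQ'.isHermitian.eq] at this
    simpa [mul_sub, sub_mul] using this
  have h2 := mpowC_mono hrX (conj hB) h1 s ⟨hs.le, hs1⟩
  rw [mpowC_smul (conj hA) r (by linarith)] at h2
  have h3 : ((r ^ s - 1) • mpowC (Q' * A * Q') s).PosDef :=
    (mpowC_posDef (conj hA) s).smul (by linarith [Real.one_lt_rpow hr hs])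
  have h4 := h3.posSemidef_add h2
  have h5 := h4.conjTranspose_mul_mul_same (B := Q) (Matrix.mulVec_injective_of_isUnit hQ.isUnit)
  rw [hQ.isHermitian.eq] at h5
  convert h5 using 1
  rw [← sub_mul, ← mul_sub, sub_smul, one_smul]
  congr 2
  abel
end
end

section
/- Let N ≥ 1, let Ω be the standard symplectic form on ℝ^{2N}, and let γ₁, γ₂ be pure quantum covariance matrices, i.e. real positive definite 2N×2N matrices satisfying γᵢ = Ω γᵢ⁻¹ Ωᵀ for i = 1, 2. Then for every t ∈ ℝ, the weighted matrix geometric mean γ₁ #_t γ₂ is also a pure quantum covariance matrix: it is positive definite and satisfies γ₁ #_t γ₂ = Ω (γ₁ #_t γ₂)⁻¹ Ωᵀ. -/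
open Matrix
open scoped ComplexOrder

noncomputable section

/-- Real power `M^t` of a (symmetric) real matrix, via the continuous functional calculus. -/
def mpowR {n : Type*} [Fintype n] [DecidableEq n] (M : Matrix n n ℝ) (t : ℝ) :
    Matrix n n ℝ :=
  cfc (fun x : ℝ => x ^ t) M

/-- The weighted matrix geometric mean `A #_t B = A^{1/2} (A^{−1/2} B A^{−1/2})^t A^{1/2}`. -/
def geomMeanR {n : Type*} [Fintype n] [DecidableEq n] (t : ℝ) (A B : Matrix n n ℝ) :
    Matrix n n ℝ :=
  mpowR A (1/2) * mpowR (mpowR A (-(1/2)) * B * mpowR A (-(1/2))) t * mpowR A (1/2)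

theorem symp_mul_transpose (N : ℕ) : symp N * (symp N)ᵀ = 1 := by
  ext i j
  have hi := i.isLt
  have hj := j.isLt
  let p : Fin (2*N) := ⟨if i.val % 2 = 0 then i.val + 1 else i.val - 1, by split_ifs <;> omega⟩
  have hp : p.val = if i.val % 2 = 0 then i.val + 1 else i.val - 1 := rfl
  rw [Matrix.mul_apply, Finset.sum_eq_single p]
  · rw [Matrix.one_apply]
    simp only [symp, Matrix.of_apply, Matrix.transpose_apply, Fin.ext_iff]
    rw [hp]
    split_ifs <;> first | omega | norm_num
  · intro k _ hk
    have hk' : k.val ≠ p.val := fun h => hk (Fin.ext h)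
    rw [hp] at hk'
    have : symp N i k = 0 := by
      simp only [symp, Matrix.of_apply]
      split_ifs at hk' ⊢ <;> first | omega | rfl
    rw [this, zero_mul]
  · simp

section aux
variable {n : Type*} [Fintype n] [DecidableEq n]

theorem spec_pos {M : Matrix n n ℝ} (h : M.PosDef) : ∀ x ∈ spectrum ℝ M, 0 < x := by
  intro x hx
  rw [h.1.spectrum_real_eq_range_eigenvalues] at hx
  obtain ⟨i, rfl⟩ := hx
  exact h.eigenvalues_pos i

theorem cont_spec (M : Matrix n n ℝ) (f : ℝ → ℝ) : ContinuousOn f (spectrum ℝ M) :=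
  (Matrix.finite_real_spectrum (A := M)).continuousOn f

theorem mpowR_add {M : Matrix n n ℝ} (h : M.PosDef) (s t : ℝ) :
    mpowR M (s + t) = mpowR M s * mpowR M t := by
  unfold mpowR
  rw [← cfc_mul _ _ M (cont_spec M _) (cont_spec M _)]
  exact cfc_congr fun x hx => Real.rpow_add (spec_pos h x hx) s t

theorem mpowR_zero {M : Matrix n n ℝ} (h : M.PosDef) : mpowR M 0 = 1 := by
  unfold mpowR
  simp only [Real.rpow_zero]
  exact cfc_const_one ℝ M (ha := h.1)

theorem mpowR_neg {M : Matrix n n ℝ} (h : M.PosDef) (s : ℝ) :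
    mpowR M (-s) = (mpowR M s)⁻¹ := by
  symm
  apply Matrix.inv_eq_right_inv
  rw [← mpowR_add h, add_neg_cancel, mpowR_zero h]

theorem mpowR_one {M : Matrix n n ℝ} (h : M.PosDef) : mpowR M 1 = M := by
  unfold mpowR
  simp only [Real.rpow_one]
  exact cfc_id' ℝ M (ha := h.1)

theorem mpowR_herm (M : Matrix n n ℝ) (s : ℝ) : (mpowR M s)ᴴ = mpowR M s :=
  (cfc_predicate (fun x : ℝ => x ^ s) M : IsSelfAdjoint _)

theorem mpowR_isUnit {M : Matrix n n ℝ} (h : M.PosDef) (s : ℝ) : IsUnit (mpowR M s) := by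
  rw [Matrix.isUnit_iff_isUnit_det]
  apply Matrix.isUnit_det_of_right_inverse (B := mpowR M (-s))
  rw [← mpowR_add h, add_neg_cancel, mpowR_zero h]

theorem posDef_conj {A M : Matrix n n ℝ} (h : M.PosDef) (hA : Aᴴ = A) (hu : IsUnit A) :
    (A * M * A).PosDef := by
  have := (Matrix.IsUnit.posDef_star_left_conjugate_iff (x := M) hu).2 h
  rwa [Matrix.star_eq_conjTranspose, hA] at this

theorem mpowR_posDef {M : Matrix n n ℝ} (h : M.PosDef) (s : ℝ) : (mpowR M s).PosDef := by
  have := posDef_conj Matrix.PosDef.one (mpowR_herm M (s/2)) (mpowR_isUnit h (s/2))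
  rwa [mul_one, ← mpowR_add h, add_halves] at this

theorem mpowR_inv {M : Matrix n n ℝ} (h : M.PosDef) (s : ℝ) :
    mpowR M⁻¹ s = (mpowR M s)⁻¹ := by
  have h1 : M⁻¹ = cfc (fun x : ℝ => x ^ (-1 : ℝ)) M := by
    have := mpowR_neg h 1
    rw [mpowR_one h] at this
    exact this.symm
  rw [← mpowR_neg h, h1]
  unfold mpowR
  refine (cfc_comp' (fun x : ℝ => x ^ s) (fun x : ℝ => x ^ (-1 : ℝ)) M
    (((Matrix.finite_real_spectrum (A := M)).image _).continuousOn _) (cont_spec M _) (ha := h.1)).symm.trans ?_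
  refine cfc_congr fun x hx => ?_
  have := spec_pos h x hx
  rw [← Real.rpow_mul this.le]
  congr 1
  ring

theorem mpowR_conj {M O : Matrix n n ℝ} (h : M.IsHermitian) (hO : O * Oᵀ = 1) (s : ℝ) :
    mpowR (O * M * Oᵀ) s = O * mpowR M s * Oᵀ := by
  have hO' : Oᵀ * O = 1 := mul_eq_one_comm.1 hO
  let u : unitary (Matrix n n ℝ) := ⟨O, by
    rw [Unitary.mem_iff]
    simp only [Matrix.star_eq_conjTranspose, Matrix.conjTranspose_eq_transpose_of_trivial]
    exact ⟨hO', hO⟩⟩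
  have key : ∀ X, Unitary.conjStarAlgAut ℝ (Matrix n n ℝ) u X = O * X * Oᵀ := by
    intro X
    rw [Unitary.conjStarAlgAut_apply]
    simp only [Matrix.star_eq_conjTranspose, Matrix.conjTranspose_eq_transpose_of_trivial, u]
  have hc : Continuous (Unitary.conjStarAlgAut ℝ (Matrix n n ℝ) u) := by
    have : (Unitary.conjStarAlgAut ℝ (Matrix n n ℝ) u : Matrix n n ℝ → Matrix n n ℝ)
      = fun X => O * X * Oᵀ := funext key
    rw [this]
    fun_prop
  have hsa : IsSelfAdjoint M := h
  have := StarAlgHomClass.map_cfc (Unitary.conjStarAlgAut ℝ (Matrix n n ℝ) u)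
    (fun x : ℝ => x ^ s) M (cont_spec M _) hc hsa (hsa.map _)
  rw [key, key] at this
  exact this.symm

theorem pure_mpowR {M O : Matrix n n ℝ} (h : M.PosDef) (hO : O * Oᵀ = 1)
    (hp : M = O * M⁻¹ * Oᵀ) (s : ℝ) :
    mpowR M s = O * (mpowR M s)⁻¹ * Oᵀ := by
  conv_lhs => rw [hp]
  rw [mpowR_conj h.1.inv hO, mpowR_inv h]

theorem pure_conj {A B O : Matrix n n ℝ} (hO : O * Oᵀ = 1)
    (hA : A = O * A⁻¹ * Oᵀ) (hB : B = O * B⁻¹ * Oᵀ) :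
    A * B * A = O * (A * B * A)⁻¹ * Oᵀ := by
  have hO' : Oᵀ * O = 1 := mul_eq_one_comm.1 hO
  have e : ∀ X Y : Matrix n n ℝ, (O * X * Oᵀ) * (O * Y * Oᵀ) = O * (X * Y) * Oᵀ := by
    intro X Y
    calc (O * X * Oᵀ) * (O * Y * Oᵀ) = O * X * (Oᵀ * O) * Y * Oᵀ := by simp only [mul_assoc]
      _ = _ := by rw [hO']; simp only [mul_assoc, mul_one]
  conv_lhs => rw [hA, hB]
  rw [e, e, Matrix.mul_inv_rev, Matrix.mul_inv_rev, mul_assoc A⁻¹]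

end aux

/-- the weighted geometric mean of two pure quantum covariance matrices is again
a pure quantum covariance matrix. -/
theorem geomMean_pure_qcm (N : ℕ) (hN : 1 ≤ N)
    (γ₁ γ₂ : Matrix (Fin (2*N)) (Fin (2*N)) ℝ)
    (h₁pd : γ₁.PosDef) (h₂pd : γ₂.PosDef)
    (h₁pure : γ₁ = symp N * γ₁⁻¹ * (symp N)ᵀ)
    (h₂pure : γ₂ = symp N * γ₂⁻¹ * (symp N)ᵀ)
    (t : ℝ) :
    (geomMeanR t γ₁ γ₂).PosDef ∧
      geomMeanR t γ₁ γ₂ = symp N * (geomMeanR t γ₁ γ₂)⁻¹ * (symp N)ᵀ := by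
  have hO := symp_mul_transpose N
  have hM : (mpowR γ₁ (-(1/2)) * γ₂ * mpowR γ₁ (-(1/2))).PosDef :=
    posDef_conj h₂pd (mpowR_herm _ _) (mpowR_isUnit h₁pd _)
  have hMp := pure_conj hO (pure_mpowR h₁pd hO h₁pure (-(1/2))) h₂pure
  exact ⟨posDef_conj (mpowR_posDef hM t) (mpowR_herm _ _) (mpowR_isUnit h₁pd _),
    pure_conj hO (pure_mpowR h₁pd hO h₁pure (1/2)) (pure_mpowR hM hO hMp t)⟩
end
end

section
/- Let P, C, V be positive definite complex Hermitian (or real symmetric) n×n matrices such that V − P is positive semidefinite and V − C is positive definite. Then for every t ∈ (0,1], the matrix V − (P #_t C) is positive definite. -/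
open Matrix
open scoped ComplexOrder

noncomputable section

open scoped MatrixOrder

lemma aux_contOn {n : ℕ} (A : Matrix (Fin n) (Fin n) ℂ) (f : ℝ → ℝ) :
    ContinuousOn f (spectrum ℝ A) :=
  (Matrix.finite_real_spectrum (A := A)).continuousOn f

lemma aux_pos {n : ℕ} {A : Matrix (Fin n) (Fin n) ℂ} (hA : A.PosDef) {x : ℝ}
    (hx : x ∈ spectrum ℝ A) : 0 < x := by
  rw [hA.isHermitian.spectrum_real_eq_range_eigenvalues] at hx
  obtain ⟨i, rfl⟩ := hx
  exact hA.eigenvalues_pos i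

lemma aux_mul {n : ℕ} {A : Matrix (Fin n) (Fin n) ℂ} (hA : A.PosDef) (s t : ℝ) :
    mpowC A s * mpowC A t = mpowC A (s + t) := by
  unfold mpowC
  rw [← cfc_mul _ _ A (aux_contOn A _) (aux_contOn A _)]
  refine cfc_congr fun x hx => ?_
  exact (Real.rpow_add (aux_pos hA hx) s t).symm

lemma aux_herm {n : ℕ} (A : Matrix (Fin n) (Fin n) ℂ) (s : ℝ) :
    (mpowC A s)ᴴ = mpowC A s :=
  (cfc_predicate (R := ℝ) (p := IsSelfAdjoint) (fun x : ℝ => x ^ s) A)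

lemma aux_zero {n : ℕ} {A : Matrix (Fin n) (Fin n) ℂ} (hA : A.PosDef) :
    mpowC A 0 = 1 := by
  unfold mpowC
  simp only [Real.rpow_zero]
  exact cfc_const_one ℝ A hA.isHermitian

lemma aux_one {n : ℕ} {A : Matrix (Fin n) (Fin n) ℂ} (hA : A.PosDef) :
    mpowC A 1 = A := by
  unfold mpowC
  simp only [Real.rpow_one]
  exact cfc_id' ℝ A hA.isHermitian

lemma aux_amgm {n : ℕ} {M : Matrix (Fin n) (Fin n) ℂ} (hM : M.PosSemidef) (t : ℝ)
    (ht : t ∈ Set.Ioc (0 : ℝ) 1) :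
    ((1 - t) • (1 : Matrix (Fin n) (Fin n) ℂ) + t • M - mpowC M t).PosSemidef := by
  have hsa : IsSelfAdjoint M := hM.isHermitian
  have h : (1 - t) • (1 : Matrix (Fin n) (Fin n) ℂ) + t • M - mpowC M t
      = cfc (fun x : ℝ => ((1 - t) + t * x) - x ^ t) M := by
    rw [cfc_sub _ _ M (aux_contOn M _) (aux_contOn M _),
      cfc_add M _ _ (aux_contOn M _) (aux_contOn M _), cfc_const _ M hsa,
      cfc_const_mul_id t M hsa, Algebra.algebraMap_eq_smul_one]
    rfl
  rw [h, ← Matrix.nonneg_iff_posSemidef]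
  refine cfc_nonneg fun x hx => ?_
  have hx0 : 0 ≤ x := by
    rw [hM.isHermitian.spectrum_real_eq_range_eigenvalues] at hx
    obtain ⟨i, rfl⟩ := hx
    exact hM.eigenvalues_nonneg i
  have := Real.geom_mean_le_arith_mean2_weighted (sub_nonneg.2 ht.2) ht.1.le zero_le_one hx0
    (by ring)
  simp only [Real.one_rpow] at this
  linarith

/-- if `P ≤ V`, `C < V` then `P #_t C < V` for all `t ∈ (0,1]`. -/
theorem geomMean_lt_of_le_of_lt {n : ℕ} (P C V : Matrix (Fin n) (Fin n) ℂ)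
    (hP : P.PosDef) (hC : C.PosDef) (hV : V.PosDef)
    (hVP : (V - P).PosSemidef) (hVC : (V - C).PosDef)
    (t : ℝ) (ht : t ∈ Set.Ioc (0 : ℝ) 1) :
    (V - geomMeanC t P C).PosDef := by
  have hXX : mpowC P (1/2) * mpowC P (1/2) = P := by
    rw [aux_mul hP]; norm_num; exact aux_one hP
  have hXY : mpowC P (1/2) * mpowC P (-(1/2)) = 1 := by
    rw [aux_mul hP, add_neg_cancel, aux_zero hP]
  have hYX : mpowC P (-(1/2)) * mpowC P (1/2) = 1 := by
    rw [aux_mul hP, neg_add_cancel, aux_zero hP]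
  have hX := aux_herm P (1/2)
  have hY := aux_herm P (-(1/2))
  unfold geomMeanC
  generalize mpowC P (1/2) = X at *
  generalize mpowC P (-(1/2)) = Y at *
  have hM : (Y * C * Y).PosSemidef := by
    have := hC.posSemidef.mul_mul_conjTranspose_same Y
    rwa [hY] at this
  have h1 := (aux_amgm hM t ht).mul_mul_conjTranspose_same X
  rw [hX] at h1
  have hXCX : X * (Y * C * Y) * X = C := by
    calc X * (Y * C * Y) * X = (X * Y) * C * (Y * X) := by noncomm_ring
      _ = C := by rw [hXY, hYX]; simp
  have h2 : X * ((1 - t) • (1 : Matrix (Fin n) (Fin n) ℂ) + t • (Y * C * Y)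
      - mpowC (Y * C * Y) t) * X = (1 - t) • P + t • C - X * mpowC (Y * C * Y) t * X := by
    rw [mul_sub, sub_mul, mul_add, add_mul, mul_smul_comm, smul_mul_assoc, mul_smul_comm,
      smul_mul_assoc, hXCX, mul_one, hXX]
  rw [h2] at h1
  have h3 : ((1 - t) • (V - P)).PosSemidef := hVP.smul (sub_nonneg.2 ht.2)
  have h4 : (t • (V - C)).PosDef := hVC.smul ht.1
  have h5 := (h4.add_posSemidef h3).add_posSemidef h1
  convert h5 using 1
  module
end
end

section
/- Let N₁, N₂ ≥ 1 with standard symplectic forms Ω₁ on ℝ^{2N₁} and Ω₂ on ℝ^{2N₂}, and let Ω := Ω₁ ⊕ Ω₂ be the block-diagonal symplectic form on ℝ^{2(N₁+N₂)}. Let γ be a real symmetric 2(N₁+N₂)×2(N₁+N₂) matrix, written in blocks as γ = [[γ₁₁, γ₁₂],[γ₁₂ᵀ, γ₂₂]], such that γ + iΩ is positive semidefinite as a complex matrix. Let V₂ be a real symmetric positive definite 2N₂×2N₂ matrix such that V₂ − iΩ₂ is positive semidefinite as a complex matrix. Then V₂ + γ₂₂ is positive definite (hence invertible), and the Schur-complement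 seed γ^{(1)} := γ₁₁ − γ₁₂ (V₂ + γ₂₂)⁻¹ γ₁₂ᵀ satisfies that γ^{(1)} + iΩ₁ is positive semidefinite, i.e. γ^{(1)} is a bona fide quantum covariance matrix for the first block. -/
open Matrix
open scoped ComplexOrder

noncomputable section

/-- the Schur complement seed `γ^{(1)} = γ₁₁ − γ₁₂(V₂+γ₂₂)⁻¹γ₁₂ᵀ` of a bona fide
two-block seed `γ` against a bona fide positive definite `V₂` is a bona fide quantum covariance
matrix for the first block (and `V₂ + γ₂₂` is positive definite). -/
theorem schur_seed_bonaFide (N₁ N₂ : ℕ) (hN₁ : 1 ≤ N₁) (hN₂ : 1 ≤ N₂)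
    (γ₁₁ : Matrix (Fin (2*N₁)) (Fin (2*N₁)) ℝ)
    (γ₁₂ : Matrix (Fin (2*N₁)) (Fin (2*N₂)) ℝ)
    (γ₂₂ : Matrix (Fin (2*N₂)) (Fin (2*N₂)) ℝ)
    (hγsymm : (Matrix.fromBlocks γ₁₁ γ₁₂ γ₁₂ᵀ γ₂₂).IsSymm)
    (hγbf : BonaFide (Matrix.fromBlocks γ₁₁ γ₁₂ γ₁₂ᵀ γ₂₂)
      (Matrix.fromBlocks (symp N₁) 0 0 (symp N₂)))
    (V₂ : Matrix (Fin (2*N₂)) (Fin (2*N₂)) ℝ)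
    (hV₂symm : V₂.IsSymm) (hV₂pd : V₂.PosDef)
    (hV₂bf : (cplx V₂ - Complex.I • cplx (symp N₂)).PosSemidef) :
    (V₂ + γ₂₂).PosDef ∧
      BonaFide (γ₁₁ - γ₁₂ * (V₂ + γ₂₂)⁻¹ * γ₁₂ᵀ) (symp N₁) := by
  have hG22s : γ₂₂ᵀ = γ₂₂ := by
    have h := hγsymm
    rw [Matrix.isSymm_fromBlocks_iff] at h
    exact h.2.2.2
  have hbf2 : (cplx γ₂₂ + Complex.I • cplx (symp N₂)).PosSemidef := by
    have h := Matrix.PosSemidef.submatrix hγbf Sum.inr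
    convert h using 1
    ext i j; simp [cplx]
  have hG22 : γ₂₂.PosSemidef := by
    refine Matrix.PosSemidef.of_dotProduct_mulVec_nonneg ?_ ?_
    · rw [Matrix.IsHermitian, Matrix.conjTranspose_eq_transpose_of_trivial, hG22s]
    · intro x
      have h := (Complex.le_def.1 (hbf2.dotProduct_mulVec_nonneg (fun i => (x i : ℂ)))).1
      simpa [cplx, dotProduct, Matrix.mulVec] using h
  have hW : (V₂ + γ₂₂).PosDef := hV₂pd.add_posSemidef hG22
  refine ⟨hW, ?_⟩
  have hdet : IsUnit (V₂ + γ₂₂).det := hW.det_pos.ne'.isUnit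
  have hWs : (V₂ + γ₂₂)ᵀ = V₂ + γ₂₂ := by rw [Matrix.transpose_add, hV₂symm.eq, hG22s]
  obtain ⟨K, hK⟩ : ∃ K, K = γ₁₂ * (V₂ + γ₂₂)⁻¹ := ⟨_, rfl⟩
  have hKW : K * (V₂ + γ₂₂) = γ₁₂ := by
    rw [hK, Matrix.mul_assoc, Matrix.nonsing_inv_mul _ hdet, Matrix.mul_one]
  have hKT : γ₁₂ * Kᵀ = K * γ₁₂ᵀ := by
    rw [← hKW, Matrix.transpose_mul, hWs, Matrix.mul_assoc]
  have hmul : ∀ {a b c : ℕ} (M : Matrix (Fin a) (Fin b) ℝ) (N : Matrix (Fin b) (Fin c) ℝ),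
      (M * N).map (fun x : ℝ => (x : ℂ)) = M.map (fun x : ℝ => (x : ℂ)) * N.map (fun x : ℝ => (x : ℂ)) :=
    fun M N => Matrix.map_mul (f := Complex.ofRealHom)
  have hKc : (K.map (fun x : ℝ => (x : ℂ)))ᴴ = Kᵀ.map (fun x : ℝ => (x : ℂ)) := by
    ext i j; simp
  have h1 := hγbf.mul_mul_conjTranspose_same
    (Matrix.fromCols (1 : Matrix (Fin (2*N₁)) (Fin (2*N₁)) ℂ) (-(K.map (fun x : ℝ => (x : ℂ)))))
  have h2 := hV₂bf.mul_mul_conjTranspose_same (K.map (fun x : ℝ => (x : ℂ)))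
  have h3 := h1.add h2
  unfold BonaFide
  rw [← hK]
  convert h3 using 1
  have hblk : cplx (Matrix.fromBlocks γ₁₁ γ₁₂ γ₁₂ᵀ γ₂₂)
      + Complex.I • cplx (Matrix.fromBlocks (symp N₁) 0 0 (symp N₂))
      = Matrix.fromBlocks (cplx γ₁₁ + Complex.I • cplx (symp N₁)) (γ₁₂.map (fun x : ℝ => (x : ℂ)))
        (γ₁₂ᵀ.map (fun x : ℝ => (x : ℂ))) (cplx γ₂₂ + Complex.I • cplx (symp N₂)) := by
    ext (i | i) (j | j) <;> simp [cplx]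
  have e1 : cplx (γ₁₁ - K * γ₁₂ᵀ) = cplx γ₁₁
      - K.map (fun x : ℝ => (x : ℂ)) * γ₁₂ᵀ.map (fun x : ℝ => (x : ℂ)) := by
    rw [← hmul]; ext i j; simp [cplx]
  have e2 : γ₁₂.map (fun x : ℝ => (x : ℂ)) * Kᵀ.map (fun x : ℝ => (x : ℂ))
      = K.map (fun x : ℝ => (x : ℂ)) * γ₁₂ᵀ.map (fun x : ℝ => (x : ℂ)) := by
    rw [← hmul, ← hmul, hKT]
  have e3 : γ₁₂.map (fun x : ℝ => (x : ℂ))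
      = K.map (fun x : ℝ => (x : ℂ)) * (cplx V₂ + cplx γ₂₂) := by
    have : cplx V₂ + cplx γ₂₂ = (V₂ + γ₂₂).map (fun x : ℝ => (x : ℂ)) := by
      ext i j; simp [cplx]
    rw [this, ← hmul, hKW]
  rw [hblk, e1, Matrix.conjTranspose_fromCols_eq_fromRows_conjTranspose, Matrix.fromCols_mul_fromBlocks,
    Matrix.fromCols_mul_fromRows, Matrix.conjTranspose_neg, hKc, Matrix.conjTranspose_one]
  generalize K.map (fun x : ℝ => (x : ℂ)) = k at *
  generalize Kᵀ.map (fun x : ℝ => (x : ℂ)) = k' at *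
  generalize γ₁₂ᵀ.map (fun x : ℝ => (x : ℂ)) = b' at *
  generalize γ₁₂.map (fun x : ℝ => (x : ℂ)) = b at *
  have e4 : k * (cplx V₂) * k' + k * (cplx γ₂₂) * k' = b * k' := by
    rw [e3, Matrix.mul_add, Matrix.add_mul]
  simp only [Matrix.mul_one, Matrix.one_mul, Matrix.neg_mul, Matrix.mul_neg, Matrix.mul_add,
    Matrix.add_mul, Matrix.mul_sub, Matrix.sub_mul, neg_add, neg_neg]
  rw [← sub_eq_zero]
  rw [← sub_eq_zero] at e4
  rw [← neg_eq_zero, ← e4]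
  abel
end
end
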